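/- Let G be a finite simple graph on a finite vertex set V and let A, B be distinct vertices. Define S(H)(X) = Σ_{J ⊆ V} (−1)^{|J|} X^{rank(adj_J(H))} ∈ ℤ[X] for a graph H on V. Then S satisfies the 4-term relation: S(G) − S(G'_{AB}) − S(G̃_{AB}) + S(G̃'_{AB}) = 0. -/

import Mathlib

open Matrix Polynomial

/-- The graph obtained from `G` by toggling (adding if absent, deleting if present)
the edge `{A, B}`. -/
def toggleEdge {V : Type*} (G : SimpleGraph V) (A B : V) : SimpleGraph V :=
  SimpleGraph.fromEdgeSet (symmDiff G.edgeSet {s(A, B)})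

/-- The graph `G̃_{AB}`: toggle the edge `{A, C}` for every vertex `C ∉ {A, B}`
that is adjacent to `B` in `G`; all other adjacencies are unchanged. -/
def gTilde {V : Type*} (G : SimpleGraph V) (A B : V) : SimpleGraph V :=
  SimpleGraph.fromEdgeSet (symmDiff G.edgeSet
    {e | ∃ C, C ≠ A ∧ C ≠ B ∧ G.Adj B C ∧ e = s(A, C)})

open Classical in
/-- The adjacency matrix over `ℤ/2ℤ` of the marked graph `(G, J)`: off-diagonal
entry `(i,j)` is `1` iff `i` and `j` are adjacent, and diagonal entry `(i,i)` is
`1` iff `i ∈ J`. -/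
noncomputable def markedAdj {V : Type*} (G : SimpleGraph V) (J : Finset V) :
    Matrix V V (ZMod 2) :=
  Matrix.of fun i j =>
    if i = j then (if i ∈ J then 1 else 0) else (if G.Adj i j then 1 else 0)

/-- `S(G)(X) = Σ_{J ⊆ V} (−1)^{|J|} X^{rank(adj_J(G))} ∈ ℤ[X]`. -/
noncomputable def polyS {V : Type*} [Fintype V] [DecidableEq V] (G : SimpleGraph V) :
    Polynomial ℤ :=
  ∑ J : Finset V, (-1 : Polynomial ℤ) ^ J.card * Polynomial.X ^ (markedAdj G J).rank

theorem toggleEdge_adj {V : Type*} (G : SimpleGraph V) {A B : V} (hAB : A ≠ B) (i j : V) :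
    (toggleEdge G A B).Adj i j ↔ Xor (G.Adj i j) (i = A ∧ j = B ∨ i = B ∧ j = A) := by
  have h := G.ne_of_adj (a := i) (b := j)
  simp only [toggleEdge, SimpleGraph.fromEdgeSet_adj, Set.mem_symmDiff, SimpleGraph.mem_edgeSet,
    Set.mem_singleton_iff, Sym2.eq_iff, Xor]
  grind

theorem gTilde_adj {V : Type*} (G : SimpleGraph V) (A B i j : V) :
    (gTilde G A B).Adj i j ↔ Xor (G.Adj i j)
      (i = A ∧ j ≠ A ∧ j ≠ B ∧ G.Adj B j ∨ j = A ∧ i ≠ A ∧ i ≠ B ∧ G.Adj B i) := by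
  have h := G.ne_of_adj (a := i) (b := j)
  have hex : (∃ C, C ≠ A ∧ C ≠ B ∧ G.Adj B C ∧ s(i, j) = s(A, C)) ↔
      (i = A ∧ j ≠ A ∧ j ≠ B ∧ G.Adj B j ∨ j = A ∧ i ≠ A ∧ i ≠ B ∧ G.Adj B i) := by
    simp only [Sym2.eq_iff]
    grind
  simp only [gTilde, SimpleGraph.fromEdgeSet_adj, Set.mem_symmDiff, SimpleGraph.mem_edgeSet,
    Set.mem_ofPred_eq, hex, Xor]
  grind

theorem toggleEdge_toggleEdge {V : Type*} (G : SimpleGraph V) {A B : V} (hAB : A ≠ B) :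
    toggleEdge (toggleEdge G A B) A B = G := by
  ext i j
  simp only [toggleEdge_adj _ hAB, Xor]
  grind

theorem gTilde_toggleEdge {V : Type*} (G : SimpleGraph V) {A B : V} (hAB : A ≠ B) :
    gTilde (toggleEdge G A B) A B = toggleEdge (gTilde G A B) A B := by
  ext i j
  simp only [toggleEdge_adj _ hAB, gTilde_adj, Xor]
  grind

/-- Adding row `B` to row `A` and column `B` to column `A` preserves the rank. -/
theorem rank_eq_of_add_row_col {V K : Type*} [Fintype V] [DecidableEq V] [Field K]
    {A B : V} (hAB : A ≠ B) (M N : Matrix V V K)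
    (h : ∀ i j, N i j = M i j + (if i = A then M B j else 0) + (if j = A then M i B else 0)
      + (if i = A ∧ j = A then M B B else 0)) : N.rank = M.rank := by
  have hN : N = transvection A B 1 * M * transvection B A 1 := by
    ext i j
    rw [h]
    by_cases hj : j = A
    · subst hj
      rw [mul_transvection_apply_same]
      by_cases hi : i = j
      · subst hi
        rw [transvection_mul_apply_same, transvection_mul_apply_same]
        simp
        ring
      · rw [transvection_mul_apply_of_ne _ _ _ _ hi, transvection_mul_apply_of_ne _ _ _ _ hi]
        simp [hi]
    · rw [mul_transvection_apply_of_ne _ _ _ _ hj]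
      by_cases hi : i = A
      · subst hi
        rw [transvection_mul_apply_same]
        simp [hj]
      · rw [transvection_mul_apply_of_ne _ _ _ _ hi]
        simp [hi, hj]
  rw [hN, rank_mul_eq_left_of_isUnit_det, rank_mul_eq_right_of_isUnit_det]
  · simp [det_transvection_of_ne _ _ hAB]
  · simp [det_transvection_of_ne _ _ hAB.symm]

theorem rank_markedAdj_gTilde {V : Type*} [Fintype V] [DecidableEq V] (G : SimpleGraph V)
    {A B : V} (hAB : A ≠ B) {J : Finset V} (hB : B ∉ J) :
    (markedAdj (gTilde G A B) J).rank = (markedAdj G J).rank := by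
  refine rank_eq_of_add_row_col hAB _ _ fun i j => ?_
  have h2 : (1 + 1 : ZMod 2) = 0 := by decide
  have hs := G.adj_comm i B
  have hadj := gTilde_adj G A B i j
  simp only [Xor] at hadj
  simp only [markedAdj, of_apply]
  grind

theorem rank_markedAdj_toggleEdge_gTilde {V : Type*} [Fintype V] [DecidableEq V]
    (G : SimpleGraph V) {A B : V} (hAB : A ≠ B) {J : Finset V} (hB : B ∈ J) :
    (markedAdj (toggleEdge (gTilde G A B) A B) (symmDiff J {A})).rank
      = (markedAdj G J).rank := by
  refine rank_eq_of_add_row_col hAB _ _ fun i j => ?_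
  have h2 : (1 + 1 : ZMod 2) = 0 := by decide
  have hs := G.adj_comm i B
  have hadj := toggleEdge_adj (gTilde G A B) hAB i j
  simp only [gTilde_adj, Xor] at hadj
  simp only [markedAdj, of_apply, Finset.mem_symmDiff, Finset.mem_singleton]
  grind

theorem neg_one_pow_card_symmDiff_singleton {V R : Type*} [DecidableEq V] [Ring R]
    (J : Finset V) (A : V) :
    (-1 : R) ^ (symmDiff J {A}).card = -(-1) ^ J.card := by
  by_cases hA : A ∈ J
  · have h : symmDiff J {A} = J.erase A := by
      ext x
      simp only [Finset.mem_symmDiff, Finset.mem_singleton, Finset.mem_erase]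
      grind
    rw [h, ← Finset.card_erase_add_one hA, pow_succ]
    simp
  · have h : symmDiff J {A} = insert A J := by
      ext x
      simp only [Finset.mem_symmDiff, Finset.mem_singleton, Finset.mem_insert]
      grind
    rw [h, Finset.card_insert_of_notMem hA, pow_succ]
    simp

/-- Toggle the membership of `A` in `J` whenever `B ∈ J`. -/
def toggleMark {V : Type*} [DecidableEq V] (A B : V) (J : Finset V) : Finset V :=
  if B ∈ J then symmDiff J {A} else J

theorem toggleMark_involutive {V : Type*} [DecidableEq V] {A B : V} (hAB : A ≠ B) :
    Function.Involutive (toggleMark A B) := by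
  intro J
  by_cases hB : B ∈ J
  · have hB' : B ∈ symmDiff J {A} := by simp [Finset.mem_symmDiff, hB, hAB.symm]
    simp [toggleMark, hB, hB']
  · simp [toggleMark, hB]

/-- `S` satisfies Lando's 4-term relation:
`S(G) − S(G'_{AB}) − S(G̃_{AB}) + S(G̃'_{AB}) = 0`. -/
theorem polyS_four_term {V : Type*} [Fintype V] [DecidableEq V]
    (G : SimpleGraph V) (A B : V) (hAB : A ≠ B) :
    polyS G - polyS (toggleEdge G A B) - polyS (gTilde G A B)
      + polyS (toggleEdge (gTilde G A B) A B) = 0 := by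
  suffices h : polyS G - polyS (toggleEdge G A B)
      = polyS (gTilde G A B) - polyS (toggleEdge (gTilde G A B) A B) by
    linear_combination h
  simp only [polyS, ← Finset.sum_sub_distrib]
  refine Fintype.sum_equiv (toggleMark_involutive hAB).toPerm _ _ fun J => ?_
  rw [Function.Involutive.coe_toPerm]
  by_cases hB : B ∈ J
  · have h₁ := rank_markedAdj_toggleEdge_gTilde G hAB hB
    have h₂ := rank_markedAdj_toggleEdge_gTilde (toggleEdge G A B) hAB hB
    rw [gTilde_toggleEdge G hAB, toggleEdge_toggleEdge _ hAB] at h₂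
    rw [toggleMark, if_pos hB, h₁, h₂, neg_one_pow_card_symmDiff_singleton]
    ring
  · have h₁ := rank_markedAdj_gTilde G hAB hB
    have h₂ := rank_markedAdj_gTilde (toggleEdge G A B) hAB hB
    rw [gTilde_toggleEdge G hAB] at h₂
    rw [toggleMark, if_neg hB, h₁, h₂]
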